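/- arXiv:0807.1165 — 12 statements merged into one kernel-verified Lean document; each statement's English description precedes it below -/
import Mathlib

section
/- The region equivalence relation on states has finite index, and the number of equivalence classes (clock regions) is at most |L| · (∏_{x∈C}(c_x+1)) · |C|! · 2^{|C|}. Formally, there is a function from the set of states L × (C → ℝ≥0) into a finite set of cardinality |L| · (∏_{x∈C}(c_x+1)) · |C|! · 2^{|C|} that assigns equal values to two states if and only if they are region-equivalent. -/
open scoped NNReal

/-- Region equivalence of clock valuations with respect to clock bounds `c`. -/
def RegionEquiv {C : Type*} (c : C → ℕ) (κ₁ κ₂ : C → ℝ≥0) : Prop :=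
  (∀ x, (κ₁ x : ℝ) ≤ c x ↔ (κ₂ x : ℝ) ≤ c x) ∧
  (∀ x, (κ₁ x : ℝ) ≤ c x → ⌊(κ₁ x : ℝ)⌋ = ⌊(κ₂ x : ℝ)⌋) ∧
  (∀ x y, (κ₁ x : ℝ) ≤ c x → (κ₁ y : ℝ) ≤ c y →
    (Int.fract (κ₁ x : ℝ) ≤ Int.fract (κ₁ y : ℝ) ↔
     Int.fract (κ₂ x : ℝ) ≤ Int.fract (κ₂ y : ℝ))) ∧
  (∀ x, (κ₁ x : ℝ) ≤ c x → (Int.fract (κ₁ x : ℝ) = 0 ↔ Int.fract (κ₂ x : ℝ) = 0))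

theorem RegionEquiv.equivalence {C : Type*} (c : C → ℕ) : Equivalence (RegionEquiv c) where
  refl κ := by simp [RegionEquiv]
  symm := by
    rintro κ₁ κ₂ ⟨hle, hfloor, hord, hzero⟩
    exact ⟨fun x => (hle x).symm, fun x hx => (hfloor x ((hle x).2 hx)).symm,
      fun x y hx hy => (hord x y ((hle x).2 hx) ((hle y).2 hy)).symm,
      fun x hx => (hzero x ((hle x).2 hx)).symm⟩
  trans := by
    rintro κ₁ κ₂ κ₃ ⟨hle, hfloor, hord, hzero⟩ ⟨hle', hfloor', hord', hzero'⟩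
    exact ⟨fun x => (hle x).trans (hle' x),
      fun x hx => (hfloor x hx).trans (hfloor' x ((hle x).1 hx)),
      fun x y hx hy => (hord x y hx hy).trans (hord' x y ((hle x).1 hx) ((hle y).1 hy)),
      fun x hx => (hzero x hx).trans (hzero' x ((hle x).1 hx))⟩

/-- A finite family of reals can be listed in nondecreasing order. -/
theorem exists_equivFin_monotone {C : Type*} [Fintype C] (g : C → ℝ) :
    ∃ e : C ≃ Fin (Fintype.card C), ∀ x y, e x ≤ e y → g x ≤ g y := by
  let e₀ := Fintype.equivFin C
  let σ := Tuple.sort (g ∘ e₀.symm)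
  refine ⟨e₀.trans σ.symm, fun x y h => ?_⟩
  simpa [σ] using Tuple.monotone_sort (g ∘ e₀.symm) h

section Jump

variable {C : Type*} {n : ℕ}

/-- In the listing `e`, the value of `g` at `z` is positive and exceeds all preceding ones. -/
def IsJump (g : C → ℝ) (e : C ≃ Fin n) (z : C) : Prop :=
  0 < g z ∧ ∀ w, e w < e z → g w < g z

variable {g : C → ℝ} {e : C ≃ Fin n}

theorem exists_isJump_of_lt {a : ℝ} (ha : 0 ≤ a) {y : C} (hy : a < g y) :
    ∃ z, a < g z ∧ e z ≤ e y ∧ IsJump g e z := by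
  obtain ⟨i, hi, hmin⟩ := WellFounded.has_min (wellFounded_lt (α := Fin n))
    {i | a < g (e.symm i)} ⟨e y, by simpa using hy⟩
  refine ⟨e.symm i, hi, ?_, ha.trans_lt hi, fun w hw => ?_⟩
  · simpa using hmin (e y) (by simpa using hy)
  · by_contra! h
    exact hmin (e w) (by simpa using lt_of_lt_of_le hi h) (by simpa using hw)

theorem pos_iff_exists_isJump (he : ∀ x y, e x ≤ e y → g x ≤ g y) (x : C) :
    0 < g x ↔ ∃ z, e z ≤ e x ∧ IsJump g e z := by
  constructor
  · intro h
    obtain ⟨z, -, hz⟩ := exists_isJump_of_lt le_rfl h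
    exact ⟨z, hz⟩
  · rintro ⟨z, hzx, hz⟩
    exact hz.1.trans_le (he z x hzx)

theorem lt_iff_exists_isJump (he : ∀ x y, e x ≤ e y → g x ≤ g y)
    (hg : ∀ x, 0 ≤ g x) (x y : C) :
    g x < g y ↔ ∃ z, e x < e z ∧ e z ≤ e y ∧ IsJump g e z := by
  constructor
  · intro h
    obtain ⟨z, hxz, hz⟩ := exists_isJump_of_lt (hg x) h
    exact ⟨z, lt_of_not_ge fun h' => hxz.not_ge (he z x h'), hz⟩
  · rintro ⟨z, hxz, hzy, hz⟩
    exact (hz.2 x hxz).trans_le (he z y hzy)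

end Jump

section Code

variable {C : Type*} (c : C → ℕ) (κ : C → ℝ≥0)

/-- The fractional part of a clock below its bound, and `0` for the other clocks. -/
noncomputable def clippedFract (x : C) : ℝ :=
  open Classical in if (κ x : ℝ) < c x then Int.fract (κ x : ℝ) else 0

theorem clippedFract_nonneg (x : C) : 0 ≤ clippedFract c κ x := by
  unfold clippedFract
  split_ifs
  exacts [Int.fract_nonneg _, le_rfl]

variable {c κ} in
theorem clippedFract_of_le {x : C} (hx : (κ x : ℝ) ≤ c x) :
    clippedFract c κ x = Int.fract (κ x : ℝ) := by
  unfold clippedFract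
  split_ifs with h
  · rfl
  · rw [le_antisymm hx (not_lt.1 h), Int.fract_natCast]

/-- The integral part of a clock, truncated at its bound. -/
noncomputable def clippedFloor (x : C) : Fin (c x + 1) :=
  ⟨min ⌊(κ x : ℝ)⌋₊ (c x), Nat.lt_succ_of_le (min_le_right _ _)⟩

theorem clippedFloor_lt_iff (x : C) : (clippedFloor c κ x : ℕ) < c x ↔ (κ x : ℝ) < c x := by
  simp [clippedFloor, Nat.floor_lt]

variable {c κ} in
theorem clippedFloor_of_le {x : C} (hx : (κ x : ℝ) ≤ c x) :
    ((clippedFloor c κ x : ℕ) : ℤ) = ⌊(κ x : ℝ)⌋ := by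
  have h : ⌊(κ x : ℝ)⌋₊ ≤ c x := Nat.floor_le_of_le hx
  simp [clippedFloor, h, Int.natCast_floor_eq_floor]

variable [Fintype C]

/-- A listing of the clocks by nondecreasing clipped fractional part. -/
noncomputable def clockListing : C ≃ Fin (Fintype.card C) :=
  (exists_equivFin_monotone (clippedFract c κ)).choose

theorem clippedFract_le_of_clockListing_le (x y : C)
    (h : clockListing c κ x ≤ clockListing c κ y) : clippedFract c κ x ≤ clippedFract c κ y :=
  (exists_equivFin_monotone (clippedFract c κ)).choose_spec x y h

/-- For a clock below its bound, whether its fractional part is a jump in the listing; for the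
other clocks, whether the bound is exceeded. -/
def clockFlag (x : C) : Prop :=
  IsJump (clippedFract c κ) (clockListing c κ) x ∨ (c x : ℝ) < κ x

theorem isJump_clippedFract_iff (x : C) :
    IsJump (clippedFract c κ) (clockListing c κ) x ↔
      clockFlag c κ x ∧ (clippedFloor c κ x : ℕ) < c x := by
  rw [clippedFloor_lt_iff, clockFlag]
  constructor
  · refine fun h => ⟨Or.inl h, ?_⟩
    by_contra hx
    simpa [clippedFract, hx] using h.1
  · rintro ⟨h | h, hx⟩
    · exact h
    · exact absurd h hx.not_gt

theorem le_bound_iff (x : C) :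
    (κ x : ℝ) ≤ c x ↔ (clippedFloor c κ x : ℕ) < c x ∨ ¬ clockFlag c κ x := by
  constructor
  · intro h
    rw [clippedFloor_lt_iff]
    refine or_iff_not_imp_left.2 fun hx hflag => ?_
    rcases hflag with hj | hlt
    · exact hx ((clippedFloor_lt_iff c κ x).1 ((isJump_clippedFract_iff c κ x).1 hj).2)
    · exact hlt.not_ge h
  · rintro (h | h)
    · exact ((clippedFloor_lt_iff c κ x).1 h).le
    · exact not_lt.1 fun h' => h (Or.inr h')

/-- The combinatorial data determining the region of a clock valuation. -/
noncomputable def regionCode :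
    (∀ x, Fin (c x + 1)) × (C ≃ Fin (Fintype.card C)) × (C → Prop) :=
  (clippedFloor c κ, clockListing c κ, clockFlag c κ)

variable {c} in
theorem regionEquiv_of_regionCode_eq {κ₁ κ₂ : C → ℝ≥0}
    (h : regionCode c κ₁ = regionCode c κ₂) : RegionEquiv c κ₁ κ₂ := by
  simp only [regionCode, Prod.mk.injEq] at h
  obtain ⟨hfloor, hlist, hflag⟩ := h
  have hle (x : C) : (κ₁ x : ℝ) ≤ c x ↔ (κ₂ x : ℝ) ≤ c x := by
    rw [le_bound_iff, le_bound_iff, hfloor, hflag]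
  have hjump (x : C) : IsJump (clippedFract c κ₁) (clockListing c κ₁) x ↔
      IsJump (clippedFract c κ₂) (clockListing c κ₂) x := by
    rw [isJump_clippedFract_iff, isJump_clippedFract_iff, hfloor, hflag]
  refine ⟨hle, fun x hx => ?_, fun x y hx hy => ?_, fun x hx => ?_⟩
  · rw [← clippedFloor_of_le hx, ← clippedFloor_of_le ((hle x).1 hx), hfloor]
  · rw [← clippedFract_of_le hx, ← clippedFract_of_le hy,
      ← clippedFract_of_le ((hle x).1 hx), ← clippedFract_of_le ((hle y).1 hy),
      ← not_lt, ← not_lt,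
      lt_iff_exists_isJump (clippedFract_le_of_clockListing_le c κ₁) (clippedFract_nonneg c κ₁),
      lt_iff_exists_isJump (clippedFract_le_of_clockListing_le c κ₂) (clippedFract_nonneg c κ₂)]
    simp only [hjump]
    rw [hlist]
  · rw [← clippedFract_of_le hx, ← clippedFract_of_le ((hle x).1 hx),
      ← not_iff_not, ← ne_eq, ← ne_eq, ← (clippedFract_nonneg c κ₁ x).lt_iff_ne',
      ← (clippedFract_nonneg c κ₂ x).lt_iff_ne',
      pos_iff_exists_isJump (clippedFract_le_of_clockListing_le c κ₁),
      pos_iff_exists_isJump (clippedFract_le_of_clockListing_le c κ₂)]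
    simp only [hjump]
    rw [hlist]

end Code

/-- The region equivalence relation on states has finite index; there is a function
from states into a finite set of cardinality `|L| · ∏ (c x + 1) · |C|! · 2^|C|`
assigning equal values to two states iff they are region-equivalent. -/
theorem region_equivalence_finite_index
    {L C : Type*} [Fintype L] [Fintype C] (c : C → ℕ) (hc : ∀ x, 0 < c x) :
    ∃ (T : Type) (f : L × (C → ℝ≥0) → T), Finite T ∧
      Nat.card T =
        Fintype.card L * (∏ x : C, (c x + 1)) *
          (Fintype.card C).factorial * 2 ^ Fintype.card C ∧
      ∀ s₁ s₂ : L × (C → ℝ≥0),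
        f s₁ = f s₂ ↔ (s₁.1 = s₂.1 ∧ RegionEquiv c s₁.2 s₂.2) := by
  let r : Setoid (L × (C → ℝ≥0)) :=
    { r := fun s₁ s₂ => s₁.1 = s₂.1 ∧ RegionEquiv c s₁.2 s₂.2
      iseqv :=
        { refl := fun s => ⟨rfl, (RegionEquiv.equivalence c).refl _⟩
          symm := fun h => ⟨h.1.symm, (RegionEquiv.equivalence c).symm h.2⟩
          trans := fun h h' => ⟨h.1.trans h'.1, (RegionEquiv.equivalence c).trans h.2 h'.2⟩ } }
  let Code := L × (∀ x, Fin (c x + 1)) × (C ≃ Fin (Fintype.card C)) × (C → Prop)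
  have hcard : Nat.card Code = Fintype.card L * (∏ x : C, (c x + 1)) *
      (Fintype.card C).factorial * 2 ^ Fintype.card C := by
    classical
    simp [Code, Nat.card_eq_fintype_card, Fintype.card_equiv (Fintype.equivFin C), mul_assoc]
  let code : L × (C → ℝ≥0) → Code := fun s => (s.1, regionCode c s.2)
  have hcode (s₁ s₂ : L × (C → ℝ≥0)) (h : code s₁ = code s₂) : r s₁ s₂ :=
    ⟨(Prod.mk.inj h).1, regionEquiv_of_regionCode_eq (Prod.mk.inj h).2⟩
  refine ⟨Fin (Nat.card Code),
    fun s => Finite.equivFin Code (code (Quotient.mk r s).out), inferInstance,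
    (Nat.card_fin _).trans hcard, fun s₁ s₂ => ?_⟩
  rw [(Finite.equivFin Code).apply_eq_iff_eq]
  constructor
  · intro h
    exact r.trans (r.symm (Quotient.mk_out s₁)) (r.trans (hcode _ _ h) (Quotient.mk_out s₂))
  · intro h
    rw [Quotient.sound (s := r) h]
end

section
/- Region equivalence preserves satisfaction of clock constraints: if κ₁ ≅ κ₂ are region-equivalent clock valuations and θ is a clock constraint in which every integer constant compared with a clock x is at most c_x, then κ₁ ⊨ θ if and only if κ₂ ⊨ θ. -/
open scoped NNReal

/-- Clock constraints: `θ ::= x ≤ d | d ≤ x | ¬θ | θ₁ ∧ θ₂`. -/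
inductive ClockConstraint (C : Type*) where
  | le  (x : C) (d : ℕ)
  | ge  (x : C) (d : ℕ)
  | not (θ : ClockConstraint C)
  | and (θ₁ θ₂ : ClockConstraint C)

/-- Satisfaction of a clock constraint by a clock valuation. -/
def ClockConstraint.sat {C : Type*} (κ : C → ℝ≥0) : ClockConstraint C → Prop
  | .le x d => (κ x : ℝ) ≤ d
  | .ge x d => (d : ℝ) ≤ κ x
  | .not θ => ¬ θ.sat κ
  | .and θ₁ θ₂ => θ₁.sat κ ∧ θ₂.sat κ

/-- A constraint respects the bounds if each constant compared with clock `x` is at most `c x`. -/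
def ClockConstraint.respectsBounds {C : Type*} (c : C → ℕ) : ClockConstraint C → Prop
  | .le x d => d ≤ c x
  | .ge x d => d ≤ c x
  | .not θ => θ.respectsBounds c
  | .and θ₁ θ₂ => θ₁.respectsBounds c ∧ θ₂.respectsBounds c

/-- A real is at most an integer iff its floor lies below it, or equals it with zero fractional
part. -/
theorem le_intCast_iff_floor_fract (a : ℝ) (d : ℤ) :
    a ≤ d ↔ ⌊a⌋ < d ∨ ⌊a⌋ = d ∧ Int.fract a = 0 := by
  rw [le_iff_lt_or_eq, ← Int.floor_lt]
  refine or_congr_right ⟨?_, fun ⟨hd, hf⟩ => ?_⟩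
  · rintro rfl
    simp
  · rw [← Int.floor_add_fract a, hd, hf, add_zero]

/-- Region-equivalent valuations agree on upper bounds `x ≤ d` with `d ≤ c x`. -/
theorem RegionEquiv.le_natCast_iff {C : Type*} {c : C → ℕ} {κ₁ κ₂ : C → ℝ≥0}
    (h : RegionEquiv c κ₁ κ₂) {x : C} {d : ℕ} (hd : d ≤ c x) :
    (κ₁ x : ℝ) ≤ d ↔ (κ₂ x : ℝ) ≤ d := by
  obtain ⟨hbound, hfloor, -, hfract⟩ := h
  have hd' : (d : ℝ) ≤ c x := by exact_mod_cast hd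
  by_cases hx : (κ₁ x : ℝ) ≤ c x
  · rw [← Int.cast_natCast, le_intCast_iff_floor_fract, le_intCast_iff_floor_fract,
      hfloor x hx, hfract x hx]
  · exact iff_of_false (fun hle => hx (hle.trans hd'))
      (fun hle => hx ((hbound x).2 (hle.trans hd')))

/-- Region-equivalent valuations agree on lower bounds `d ≤ x` with `d ≤ c x`. -/
theorem RegionEquiv.natCast_le_iff {C : Type*} {c : C → ℕ} {κ₁ κ₂ : C → ℝ≥0}
    (h : RegionEquiv c κ₁ κ₂) {x : C} {d : ℕ} (hd : d ≤ c x) :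
    (d : ℝ) ≤ κ₁ x ↔ (d : ℝ) ≤ κ₂ x := by
  obtain ⟨hbound, hfloor, -, -⟩ := h
  have hd' : (d : ℝ) ≤ c x := by exact_mod_cast hd
  by_cases hx : (κ₁ x : ℝ) ≤ c x
  · rw [← Int.cast_natCast, ← Int.le_floor, ← Int.le_floor, hfloor x hx]
  · have hx₂ : ¬ (κ₂ x : ℝ) ≤ c x := fun hle => hx ((hbound x).2 hle)
    exact iff_of_true (hd'.trans (not_le.1 hx).le) (hd'.trans (not_le.1 hx₂).le)

/-- Region equivalence preserves satisfaction of clock constraints that respect the bounds. -/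
theorem regionEquiv_preserves_constraints
    {C : Type*} [Fintype C] (c : C → ℕ) (hc : ∀ x, 0 < c x)
    (κ₁ κ₂ : C → ℝ≥0) (h : RegionEquiv c κ₁ κ₂)
    (θ : ClockConstraint C) (hθ : θ.respectsBounds c) :
    θ.sat κ₁ ↔ θ.sat κ₂ := by
  induction θ with
  | le x d => exact h.le_natCast_iff hθ
  | ge x d => exact h.natCast_le_iff hθ
  | not θ ih => exact not_congr (ih hθ)
  | and θ₁ θ₂ ih₁ ih₂ => exact and_congr (ih₁ hθ.1) (ih₂ hθ.2)
end

section
/- Region equivalence is preserved by clock resets: if κ₁ ≅ κ₂ are region-equivalent clock valuations and λ ⊆ C is any set of clocks, then κ₁[λ:=0] ≅ κ₂[λ:=0]. -/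
open scoped NNReal

/-- Region equivalence is preserved by clock resets. -/
theorem regionEquiv_reset
    {C : Type*} [Fintype C] (c : C → ℕ) (hc : ∀ x, 0 < c x)
    (κ₁ κ₂ : C → ℝ≥0) (h : RegionEquiv c κ₁ κ₂)
    (lam : Set C) [DecidablePred (· ∈ lam)] :
    RegionEquiv c (fun x => if x ∈ lam then 0 else κ₁ x)
      (fun x => if x ∈ lam then 0 else κ₂ x) := by
  obtain ⟨hle, hfloor, hfract, hzero⟩ := h
  have fract_le_zero (t : ℝ) : Int.fract t ≤ 0 ↔ Int.fract t = 0 :=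
    (Int.fract_nonneg t).ge_iff_eq'
  refine ⟨fun x => ?_, fun x hx => ?_, fun x y hx hy => ?_, fun x hx => ?_⟩
  · by_cases hxl : x ∈ lam <;> simp [hxl, hle x]
  · by_cases hxl : x ∈ lam
    · simp [hxl]
    · simp only [hxl, if_false] at hx ⊢
      exact hfloor x hx
  · by_cases hxl : x ∈ lam
    · simp [hxl]
    · by_cases hyl : y ∈ lam
      · simp only [hxl, hyl, if_false, if_true, NNReal.coe_zero, Int.fract_zero,
          fract_le_zero] at hx ⊢
        exact hzero x hx
      · simp only [hxl, hyl, if_false] at hx hy ⊢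
        exact hfract x y hx hy
  · by_cases hxl : x ∈ lam
    · simp [hxl]
    · simp only [hxl, if_false] at hx ⊢
      exact hzero x hx
end

section
/- Region equivalence is a time-abstract bisimulation: if κ₁ ≅ κ₂ are region-equivalent clock valuations, then for every time delay Δ₁ ∈ ℝ≥0 there exists a time delay Δ₂ ∈ ℝ≥0 such that κ₁+Δ₁ ≅ κ₂+Δ₂. -/
open scoped NNReal

/-- Comparison of a real with an integer depends only on its floor and the vanishing of its
fractional part. -/
lemma le_intCast_iff_of_floor_eq {u v : ℝ} (hfl : ⌊u⌋ = ⌊v⌋)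
    (hfr : Int.fract u = 0 ↔ Int.fract v = 0) (m : ℤ) : u ≤ m ↔ v ≤ m := by
  have key : ∀ w : ℝ, w ≤ m ↔ ⌊w⌋ < m ∨ (⌊w⌋ = m ∧ Int.fract w = 0) := by
    intro w
    have hw := Int.floor_add_fract w
    have h0 := Int.fract_nonneg w
    constructor
    · intro h
      rcases lt_or_eq_of_le ((Int.floor_le_floor h).trans_eq (Int.floor_intCast m)) with h' | h'
      · exact Or.inl h'
      · refine Or.inr ⟨h', ?_⟩
        rw [h'] at hw
        linarith
    · rintro (h | ⟨h, h'⟩)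
      · exact (Int.floor_lt.mp h).le
      · rw [h, h'] at hw
        linarith
  rw [key u, key v, hfl, hfr]

/-- Adding `n + δ` with `0 ≤ δ < 1` when the fractional parts do not carry. -/
lemma floor_fract_add_of_lt {v δ : ℝ} (n : ℤ) (hδ : 0 ≤ δ) (h : Int.fract v < 1 - δ) :
    ⌊v + (n + δ)⌋ = ⌊v⌋ + n ∧ Int.fract (v + (n + δ)) = Int.fract v + δ := by
  have hv := Int.floor_add_fract v
  have h0 := Int.fract_nonneg v
  have hfl : ⌊v + (n + δ)⌋ = ⌊v⌋ + n := by
    rw [Int.floor_eq_iff]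
    push_cast
    constructor <;> linarith
  refine ⟨hfl, ?_⟩
  rw [Int.fract, hfl]
  push_cast
  linarith

/-- Adding `n + δ` with `0 ≤ δ < 1` when the fractional parts carry. -/
lemma floor_fract_add_of_le {v δ : ℝ} (n : ℤ) (hδ : δ < 1) (h : 1 - δ ≤ Int.fract v) :
    ⌊v + (n + δ)⌋ = ⌊v⌋ + n + 1 ∧ Int.fract (v + (n + δ)) = Int.fract v + δ - 1 := by
  have hv := Int.floor_add_fract v
  have h1 := Int.fract_lt_one v
  have hfl : ⌊v + (n + δ)⌋ = ⌊v⌋ + n + 1 := by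
    rw [Int.floor_eq_iff]
    push_cast
    constructor <;> linarith
  refine ⟨hfl, ?_⟩
  rw [Int.fract, hfl]
  push_cast
  linarith

/-- Two finite families in `[0, 1)` with the same order type and the same zeros admit matching
cut points in `(0, 1]`. -/
lemma exists_matching_cut {ι : Type*} [Finite ι] (f g : ι → ℝ)
    (hf1 : ∀ i, f i < 1) (hg0 : ∀ i, 0 ≤ g i) (hg1 : ∀ i, g i < 1)
    (hfg : ∀ i j, f i ≤ f j ↔ g i ≤ g j) (hzero : ∀ i, f i = 0 ↔ g i = 0)
    (t : ℝ) (ht0 : 0 < t) (ht1 : t ≤ 1) :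
    ∃ s : ℝ, 0 < s ∧ s ≤ 1 ∧ (t = 1 ↔ s = 1) ∧ (∀ i, f i < t ↔ g i < s) ∧
      (∀ i, f i = t ↔ g i = s) := by
  classical
  have := Fintype.ofFinite ι
  have hlt : ∀ i j, f i < f j ↔ g i < g j := fun i j => by
    rw [← not_le, ← not_le, hfg]
  rcases ht1.eq_or_lt with rfl | ht1
  · exact ⟨1, one_pos, le_rfl, by simp, fun i => by simp [hf1 i, hg1 i],
      fun i => by simp [(hf1 i).ne, (hg1 i).ne]⟩
  by_cases hex : ∃ i, f i = t
  · obtain ⟨i, rfl⟩ := hex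
    refine ⟨g i, lt_of_le_of_ne (hg0 i) fun h => ht0.ne' ((hzero i).2 h.symm), (hg1 i).le,
      by simp [ht1.ne, (hg1 i).ne], fun j => hlt j i, fun j => ?_⟩
    rw [le_antisymm_iff, le_antisymm_iff, hfg, hfg]
  · push Not at hex
    obtain ⟨s, hlo, hhi⟩ := Order.exists_between_finsets
      (insert 0 ((Finset.univ.filter fun i => f i < t).image g))
      (insert 1 ((Finset.univ.filter fun i => t < f i).image g)) (by
        simp only [Finset.mem_insert, Finset.mem_image, Finset.mem_filter, Finset.mem_univ,
          true_and]
        rintro _ (rfl | ⟨i, hi, rfl⟩) _ (rfl | ⟨j, hj, rfl⟩)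
        · exact one_pos
        · exact lt_of_le_of_ne (hg0 j) fun h => (ht0.trans hj).ne' ((hzero j).2 h.symm)
        · exact hg1 i
        · exact (hlt i j).1 (hi.trans hj))
    have hs1 : s < 1 := hhi 1 (by simp)
    have hL : ∀ i, f i < t → g i < s := fun i hi => hlo _ (by
      simp only [Finset.mem_insert, Finset.mem_image, Finset.mem_filter, Finset.mem_univ,
        true_and]
      exact Or.inr ⟨i, hi, rfl⟩)
    have hU : ∀ i, t < f i → s < g i := fun i hi => hhi _ (by
      simp only [Finset.mem_insert, Finset.mem_image, Finset.mem_filter, Finset.mem_univ,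
        true_and]
      exact Or.inr ⟨i, hi, rfl⟩)
    refine ⟨s, hlo 0 (by simp), hs1.le, by simp [ht1.ne, hs1.ne], fun i => ?_, fun i => ?_⟩
    · rcases lt_or_gt_of_ne (hex i) with h | h
      · simp [h, hL i h]
      · simp [h.not_gt, (hU i h).not_gt]
    · rcases lt_or_gt_of_ne (hex i) with h | h
      · simp [h.ne, (hL i h).ne]
      · simp [h.ne', (hU i h).ne']

/-- Matching delays preserve integer parts, the order of fractional parts, and their zeros. -/
lemma exists_matching_delay {ι : Type*} [Finite ι] (u v : ι → ℝ) (hfl : ∀ i, ⌊u i⌋ = ⌊v i⌋)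
    (hle : ∀ i j, Int.fract (u i) ≤ Int.fract (u j) ↔ Int.fract (v i) ≤ Int.fract (v j))
    (hzero : ∀ i, Int.fract (u i) = 0 ↔ Int.fract (v i) = 0) (d : ℝ) (hd : 0 ≤ d) :
    ∃ e : ℝ, 0 ≤ e ∧ (∀ i, ⌊u i + d⌋ = ⌊v i + e⌋) ∧
      (∀ i j, Int.fract (u i + d) ≤ Int.fract (u j + d) ↔
        Int.fract (v i + e) ≤ Int.fract (v j + e)) ∧
      (∀ i, Int.fract (u i + d) = 0 ↔ Int.fract (v i + e) = 0) := by
  have hδ0 := Int.fract_nonneg d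
  have hδ1 := Int.fract_lt_one d
  have hn : (0 : ℝ) ≤ ⌊d⌋ := by exact_mod_cast Int.floor_nonneg.2 hd
  obtain ⟨s, hs0, hs1, hts, hlt, heq⟩ := exists_matching_cut (fun i => Int.fract (u i))
    (fun i => Int.fract (v i)) (fun i => Int.fract_lt_one _) (fun i => Int.fract_nonneg _)
    (fun i => Int.fract_lt_one _) hle hzero (1 - Int.fract d) (by linarith) (by linarith)
  rw [← Int.floor_add_fract d]
  generalize ⌊d⌋ = n at *
  generalize Int.fract d = δ at *
  obtain ⟨ε, rfl⟩ : ∃ ε, s = 1 - ε := ⟨1 - s, by ring⟩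
  have hδε : δ = 0 ↔ ε = 0 := by simpa using hts
  have hε0 : 0 ≤ ε := by linarith
  have hε1 : ε < 1 := by linarith
  have key : ∀ i,
      (⌊u i + (n + δ)⌋ = ⌊u i⌋ + n ∧ Int.fract (u i + (n + δ)) = Int.fract (u i) + δ ∧
        ⌊v i + (n + ε)⌋ = ⌊v i⌋ + n ∧ Int.fract (v i + (n + ε)) = Int.fract (v i) + ε) ∨
      (⌊u i + (n + δ)⌋ = ⌊u i⌋ + n + 1 ∧ Int.fract (u i + (n + δ)) = Int.fract (u i) + δ - 1 ∧
        ⌊v i + (n + ε)⌋ = ⌊v i⌋ + n + 1 ∧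
        Int.fract (v i + (n + ε)) = Int.fract (v i) + ε - 1) := by
    intro i
    rcases lt_or_ge (Int.fract (u i)) (1 - δ) with h | h
    · obtain ⟨h1, h2⟩ := floor_fract_add_of_lt n hδ0 h
      obtain ⟨h3, h4⟩ := floor_fract_add_of_lt n hε0 ((hlt i).1 h)
      exact Or.inl ⟨h1, h2, h3, h4⟩
    · obtain ⟨h1, h2⟩ := floor_fract_add_of_le n hδ1 h
      obtain ⟨h3, h4⟩ := floor_fract_add_of_le n hε1
        (not_lt.1 fun h' => h.not_gt ((hlt i).2 h'))
      exact Or.inr ⟨h1, h2, h3, h4⟩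
  refine ⟨n + ε, by linarith, fun i => ?_, fun i j => ?_, fun i => ?_⟩
  · rcases key i with ⟨h1, -, h3, -⟩ | ⟨h1, -, h3, -⟩ <;> rw [h1, h3, hfl]
  · have := Int.fract_lt_one (u i)
    have := Int.fract_lt_one (v i)
    have := Int.fract_lt_one (u j)
    have := Int.fract_lt_one (v j)
    have := Int.fract_nonneg (u i)
    have := Int.fract_nonneg (v i)
    have := Int.fract_nonneg (u j)
    have := Int.fract_nonneg (v j)
    have hij := hle i j
    rcases key i with ⟨-, h2, -, h4⟩ | ⟨-, h2, -, h4⟩ <;>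
    rcases key j with ⟨-, h2', -, h4'⟩ | ⟨-, h2', -, h4'⟩ <;> rw [h2, h4, h2', h4']
    · simpa using hij
    · constructor <;> intro <;> linarith
    · constructor <;> intro <;> linarith
    · simpa using hij
  · have hu := Int.fract_nonneg (u i)
    have hv := Int.fract_nonneg (v i)
    rcases key i with ⟨-, h2, -, h4⟩ | ⟨-, h2, -, h4⟩ <;> rw [h2, h4]
    · rw [add_eq_zero_iff_of_nonneg hu hδ0, add_eq_zero_iff_of_nonneg hv hε0, hzero, hδε]
    · have := heq i
      rw [eq_sub_iff_add_eq, eq_sub_iff_add_eq] at this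
      rwa [sub_eq_zero, sub_eq_zero]

/-- Region equivalence is a time-abstract bisimulation. -/
theorem regionEquiv_time_abstract_bisim
    {C : Type*} [Fintype C] (c : C → ℕ) (hc : ∀ x, 0 < c x)
    (κ₁ κ₂ : C → ℝ≥0) (h : RegionEquiv c κ₁ κ₂) (Δ₁ : ℝ≥0) :
    ∃ Δ₂ : ℝ≥0, RegionEquiv c (fun x => κ₁ x + Δ₁) (fun x => κ₂ x + Δ₂) := by
  obtain ⟨hbd, hfl, hle, hzero⟩ := h
  obtain ⟨e, he, hfl', hle', hzero'⟩ := exists_matching_delay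
    (fun x : {x // (κ₁ x : ℝ) ≤ c x} => (κ₁ x : ℝ)) (fun x => (κ₂ x : ℝ))
    (fun x => hfl x x.2) (fun x y => hle x y x.2 y.2) (fun x => hzero x x.2) Δ₁ Δ₁.2
  lift e to ℝ≥0 using he
  have hsmall : ∀ x, ((κ₁ x + Δ₁ : ℝ≥0) : ℝ) ≤ c x → (κ₁ x : ℝ) ≤ c x := fun x hx => by
    push_cast at hx
    linarith [Δ₁.coe_nonneg]
  refine ⟨e, fun x => ?_, fun x hx => ?_, fun x y hx hy => ?_, fun x hx => ?_⟩
  · by_cases hx : (κ₁ x : ℝ) ≤ c x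
    · simpa using le_intCast_iff_of_floor_eq (hfl' ⟨x, hx⟩) (hzero' ⟨x, hx⟩) (c x)
    · have hx' := mt (hbd x).2 hx
      push_cast
      constructor <;> intro <;> linarith [Δ₁.coe_nonneg, e.coe_nonneg]
  · simpa using hfl' ⟨x, hsmall x hx⟩
  · simpa using hle' ⟨x, hsmall x hx⟩ ⟨y, hsmall y hy⟩
  · simpa using hzero' ⟨x, hsmall x hx⟩
end

section
/- The set of time-successor regions is invariant under region equivalence: if κ₁ ≅ κ₂ are region-equivalent clock valuations, then the two sets of regions { [κ₁+Δ] : Δ ∈ ℝ≥0 } and { [κ₂+Δ] : Δ ∈ ℝ≥0 } are equal, where [κ] denotes the region-equivalence class of κ. Hence the set of time-successor regions of a region is well defined. -/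
open scoped NNReal

/-- The region (equivalence class) of a clock valuation. -/
def regionOf {C : Type*} (c : C → ℕ) (κ : C → ℝ≥0) : Set (C → ℝ≥0) :=
  {κ' | RegionEquiv c κ κ'}

theorem RegionEquiv.symm {C : Type*} {c : C → ℕ} {κ₁ κ₂ : C → ℝ≥0}
    (h : RegionEquiv c κ₁ κ₂) : RegionEquiv c κ₂ κ₁ := by
  obtain ⟨ha, hb, hf, hz⟩ := h
  exact ⟨fun x => (ha x).symm, fun x hx => (hb x ((ha x).2 hx)).symm,
    fun x y hx hy => (hf x y ((ha x).2 hx) ((ha y).2 hy)).symm,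
    fun x hx => (hz x ((ha x).2 hx)).symm⟩

theorem RegionEquiv.trans {C : Type*} {c : C → ℕ} {κ₁ κ₂ κ₃ : C → ℝ≥0}
    (h : RegionEquiv c κ₁ κ₂) (h' : RegionEquiv c κ₂ κ₃) : RegionEquiv c κ₁ κ₃ := by
  obtain ⟨ha, hb, hf, hz⟩ := h
  obtain ⟨ha', hb', hf', hz'⟩ := h'
  exact ⟨fun x => (ha x).trans (ha' x),
    fun x hx => (hb x hx).trans (hb' x ((ha x).1 hx)),
    fun x y hx hy => (hf x y hx hy).trans (hf' x y ((ha x).1 hx) ((ha y).1 hy)),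
    fun x hx => (hz x hx).trans (hz' x ((ha x).1 hx))⟩

theorem RegionEquiv.regionOf_eq {C : Type*} {c : C → ℕ} {κ₁ κ₂ : C → ℝ≥0}
    (h : RegionEquiv c κ₁ κ₂) : regionOf c κ₁ = regionOf c κ₂ :=
  Set.ext fun _ => ⟨fun h' => h.symm.trans h', fun h' => h.trans h'⟩

/-- Adding `N + δ` with `0 ≤ δ < 1` either carries into the integer part or does not. -/
theorem floor_fract_add_cases (v : ℝ) (N : ℤ) {δ : ℝ} (h0 : 0 ≤ δ) (h1 : δ < 1) :
    (Int.fract v + δ < 1 ∧ ⌊v + (N + δ)⌋ = ⌊v⌋ + N ∧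
      Int.fract (v + (N + δ)) = Int.fract v + δ) ∨
    (1 ≤ Int.fract v + δ ∧ ⌊v + (N + δ)⌋ = ⌊v⌋ + N + 1 ∧
      Int.fract (v + (N + δ)) = Int.fract v + δ - 1) := by
  have hv := Int.floor_add_fract v
  have hv0 := Int.fract_nonneg v
  have hv1 := Int.fract_lt_one v
  rcases lt_or_ge (Int.fract v + δ) 1 with h | h
  · have hfl : ⌊v + (N + δ)⌋ = ⌊v⌋ + N := by
      rw [Int.floor_eq_iff]; push_cast; constructor <;> linarith
    refine Or.inl ⟨h, hfl, ?_⟩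
    rw [Int.fract, hfl]; push_cast; linarith
  · have hfl : ⌊v + (N + δ)⌋ = ⌊v⌋ + N + 1 := by
      rw [Int.floor_eq_iff]; push_cast; constructor <;> linarith
    refine Or.inr ⟨h, hfl, ?_⟩
    rw [Int.fract, hfl]; push_cast; linarith

theorem le_natCast_iff_floor_fract (v : ℝ) (n : ℕ) :
    v ≤ n ↔ ⌊v⌋ < n ∨ (⌊v⌋ = n ∧ Int.fract v = 0) := by
  have hv := Int.floor_add_fract v
  have hv0 := Int.fract_nonneg v
  rw [Int.floor_lt]
  constructor
  · intro h
    rcases h.lt_or_eq with h | h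
    · exact Or.inl (by exact_mod_cast h)
    · exact Or.inr (by subst h; simp)
  · rintro (h | ⟨h, h'⟩)
    · exact le_of_lt (by exact_mod_cast h)
    · rw [h, h'] at hv; push_cast at hv; linarith

/-- A delay `δ ∈ [0, 1)` can be transported along an order isomorphism between two finite families
of fractional parts, preserving its position relative to every carry. -/
theorem exists_delay_of_fract_order {ι : Type*} [Finite ι] {f g : ι → ℝ}
    (hf0 : ∀ i, 0 ≤ f i) (hf1 : ∀ i, f i < 1) (hg0 : ∀ i, 0 ≤ g i) (hg1 : ∀ i, g i < 1)
    (hle : ∀ i j, f i ≤ f j ↔ g i ≤ g j) (hz : ∀ i, f i = 0 ↔ g i = 0)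
    {δ : ℝ} (h0 : 0 ≤ δ) (h1 : δ < 1) :
    ∃ δ' : ℝ, 0 ≤ δ' ∧ δ' < 1 ∧ (δ = 0 ↔ δ' = 0) ∧
      (∀ i, f i + δ < 1 ↔ g i + δ' < 1) ∧ (∀ i, f i + δ = 1 ↔ g i + δ' = 1) := by
  cases nonempty_fintype ι
  have hpos : ∀ i, 0 < f i ↔ 0 < g i := fun i => by
    rw [(hf0 i).lt_iff_ne', (hg0 i).lt_iff_ne', Ne, Ne, hz]
  have hlt : ∀ i j, f i < f j ↔ g i < g j := fun i j => by
    rw [← not_le, ← not_le, hle]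
  rcases h0.eq_or_lt with rfl | hδ
  · exact ⟨0, le_rfl, h1, by simp, fun i => by simp [hf1 i, hg1 i],
      fun i => by simp [(hf1 i).ne, (hg1 i).ne]⟩
  by_cases hex : ∃ i, f i + δ = 1
  · obtain ⟨i, hi⟩ := hex
    have hgi : 0 < g i := (hpos i).1 (by linarith)
    refine ⟨1 - g i, by linarith [hg1 i], by linarith, ?_, fun j => ?_, fun j => ?_⟩
    · exact ⟨fun h => by linarith, fun h => by linarith [hg1 i]⟩
    · have := hlt j i
      constructor <;> intro h
      · linarith [this.1 (by linarith)]
      · linarith [this.2 (by linarith)]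
    · have h₁ := hle j i
      have h₂ := hle i j
      constructor <;> intro h
      · linarith [h₁.1 (by linarith), h₂.1 (by linarith)]
      · linarith [h₁.2 (by linarith), h₂.2 (by linarith)]
  push Not at hex
  classical
  obtain ⟨δ', hlo, hhi⟩ := Order.exists_between_finsets
    (insert 0 ((Finset.univ.filter fun i => 1 < f i + δ).image fun i => 1 - g i))
    (insert 1 ((Finset.univ.filter fun i => f i + δ < 1).image fun i => 1 - g i)) (by
      simp only [Finset.mem_insert, Finset.mem_image, Finset.mem_filter, Finset.mem_univ, true_and]
      rintro _ (rfl | ⟨i, hi, rfl⟩) _ (rfl | ⟨j, hj, rfl⟩)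
      · exact one_pos
      · linarith [hg1 j]
      · linarith [(hpos i).1 (by linarith)]
      · linarith [(hlt j i).1 (by linarith)])
  simp only [Finset.mem_insert, Finset.mem_image, Finset.mem_filter, Finset.mem_univ, true_and,
    forall_eq_or_imp, forall_exists_index, and_imp, forall_apply_eq_imp_iff₂] at hlo hhi
  refine ⟨δ', hlo.1.le, hhi.1, by simp [hδ.ne', hlo.1.ne'], fun i => ?_, fun i => ?_⟩ <;>
  rcases (hex i).lt_or_gt with h | h
  · have := hhi.2 i h
    exact iff_of_true h (by linarith)
  · have := hlo.2 i h
    exact iff_of_false (by linarith) (by linarith)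
  · have := hhi.2 i h
    exact iff_of_false h.ne (by linarith)
  · have := hlo.2 i h
    exact iff_of_false h.ne' (by linarith)

theorem RegionEquiv.exists_delay {C : Type*} [Finite C] {c : C → ℕ} {κ₁ κ₂ : C → ℝ≥0}
    (h : RegionEquiv c κ₁ κ₂) (Δ : ℝ≥0) :
    ∃ Δ' : ℝ≥0, RegionEquiv c (fun x => κ₁ x + Δ) (fun x => κ₂ x + Δ') := by
  obtain ⟨ha, hb, hf, hz⟩ := h
  obtain ⟨δ', h0', h1', hδ, hlt, heq⟩ := exists_delay_of_fract_order
    (ι := {x // (κ₁ x : ℝ) ≤ c x})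
    (f := fun x => Int.fract (κ₁ x : ℝ)) (g := fun x => Int.fract (κ₂ x : ℝ))
    (fun _ => Int.fract_nonneg _) (fun _ => Int.fract_lt_one _)
    (fun _ => Int.fract_nonneg _) (fun _ => Int.fract_lt_one _)
    (fun x y => hf x y x.2 y.2) (fun x => hz x x.2)
    (Int.fract_nonneg (Δ : ℝ)) (Int.fract_lt_one (Δ : ℝ))
  have h0 := Int.fract_nonneg (Δ : ℝ)
  have h1 := Int.fract_lt_one (Δ : ℝ)
  have hΔ := Int.floor_add_fract (Δ : ℝ)
  have hN : (0 : ℝ) ≤ ⌊(Δ : ℝ)⌋ := by exact_mod_cast Int.floor_nonneg.2 Δ.2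
  generalize ⌊(Δ : ℝ)⌋ = N at hΔ hN
  generalize Int.fract (Δ : ℝ) = δ at *
  have hcase₁ := fun x => floor_fract_add_cases (κ₁ x) N h0 h1
  have hcase₂ := fun x => floor_fract_add_cases (κ₂ x) N h0' h1'
  have hfloor : ∀ x, (κ₁ x : ℝ) ≤ c x →
      ⌊(κ₁ x : ℝ) + (N + δ)⌋ = ⌊(κ₂ x : ℝ) + (N + δ')⌋ := fun x hx => by
    have hl := hlt ⟨x, hx⟩
    have hb := hb x hx
    rcases hcase₁ x with ⟨p, q, -⟩ | ⟨p, q, -⟩ <;> rcases hcase₂ x with ⟨p', q', -⟩ | ⟨p', q', -⟩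
    · omega
    · exact absurd (hl.1 p) p'.not_gt
    · exact absurd (hl.2 p') p.not_gt
    · omega
  have hzero : ∀ x, (κ₁ x : ℝ) ≤ c x → (Int.fract ((κ₁ x : ℝ) + (N + δ)) = 0 ↔
      Int.fract ((κ₂ x : ℝ) + (N + δ')) = 0) := fun x hx => by
    have hl := hlt ⟨x, hx⟩
    have he := heq ⟨x, hx⟩
    have hz := hz x hx
    have n₁ := Int.fract_nonneg (κ₁ x : ℝ)
    have n₂ := Int.fract_nonneg (κ₂ x : ℝ)
    rcases hcase₁ x with ⟨p, -, q⟩ | ⟨p, -, q⟩ <;> rcases hcase₂ x with ⟨p', -, q'⟩ | ⟨p', -, q'⟩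
    · rw [q, q', add_eq_zero_iff_of_nonneg n₁ h0, add_eq_zero_iff_of_nonneg n₂ h0', hz, hδ]
    · exact absurd (hl.1 p) p'.not_gt
    · exact absurd (hl.2 p') p.not_gt
    · rw [q, q', sub_eq_zero, sub_eq_zero, he]
  have hbound : ∀ x, (κ₁ x : ℝ) + (N + δ) ≤ c x ↔ (κ₂ x : ℝ) + (N + δ') ≤ c x := fun x => by
    by_cases hx : (κ₁ x : ℝ) ≤ c x
    · rw [le_natCast_iff_floor_fract, le_natCast_iff_floor_fract, hfloor x hx, hzero x hx]
    · have hx' := mt (ha x).2 hx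
      exact iff_of_false (by linarith) (by linarith)
  have hactive : ∀ x, (κ₁ x : ℝ) + (N + δ) ≤ c x → (κ₁ x : ℝ) ≤ c x := fun x hx => by linarith
  obtain ⟨Δ', hΔ'⟩ : ∃ Δ' : ℝ≥0, N + δ' = (Δ' : ℝ) :=
    ⟨(N + δ').toNNReal, (Real.coe_toNNReal _ (by linarith)).symm⟩
  refine ⟨Δ', ?_⟩
  simp only [RegionEquiv, NNReal.coe_add, ← hΔ, ← hΔ']
  refine ⟨hbound, fun x hx => hfloor x (hactive x hx), fun x y hx hy => ?_,
    fun x hx => hzero x (hactive x hx)⟩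
  have hx := hactive x hx
  have hy := hactive y hy
  have hlx := hlt ⟨x, hx⟩
  have hly := hlt ⟨y, hy⟩
  have hxy := hf x y hx hy
  have carry : ∀ {v w : ℝ} {ε : ℝ}, ¬ Int.fract v + ε ≤ Int.fract w + ε - 1 := fun {v w ε} => by
    linarith [Int.fract_nonneg v, Int.fract_lt_one w]
  have carry' : ∀ {v w : ℝ} {ε : ℝ}, Int.fract v + ε - 1 ≤ Int.fract w + ε := fun {v w ε} => by
    linarith [Int.fract_nonneg w, Int.fract_lt_one v]
  rcases hcase₁ x with ⟨p, -, q⟩ | ⟨p, -, q⟩ <;> rcases hcase₂ x with ⟨p', -, q'⟩ | ⟨p', -, q'⟩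
  · rcases hcase₁ y with ⟨r, -, s⟩ | ⟨r, -, s⟩ <;> rcases hcase₂ y with ⟨r', -, s'⟩ | ⟨r', -, s'⟩
    · rw [q, q', s, s', add_le_add_iff_right, add_le_add_iff_right, hxy]
    · exact absurd (hly.1 r) r'.not_gt
    · exact absurd (hly.2 r') r.not_gt
    · rw [q, q', s, s']; exact iff_of_false carry carry
  · exact absurd (hlx.1 p) p'.not_gt
  · exact absurd (hlx.2 p') p.not_gt
  · rcases hcase₁ y with ⟨r, -, s⟩ | ⟨r, -, s⟩ <;> rcases hcase₂ y with ⟨r', -, s'⟩ | ⟨r', -, s'⟩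
    · rw [q, q', s, s']; exact iff_of_true carry' carry'
    · exact absurd (hly.1 r) r'.not_gt
    · exact absurd (hly.2 r') r.not_gt
    · rw [q, q', s, s', sub_le_sub_iff_right, sub_le_sub_iff_right, add_le_add_iff_right,
        add_le_add_iff_right, hxy]

/-- The set of time-successor regions is invariant under region equivalence. -/
theorem timeSuccessor_regions_well_defined
    {C : Type*} [Fintype C] (c : C → ℕ) (hc : ∀ x, 0 < c x)
    (κ₁ κ₂ : C → ℝ≥0) (h : RegionEquiv c κ₁ κ₂) :
    {R : Set (C → ℝ≥0) | ∃ Δ : ℝ≥0, R = regionOf c (fun x => κ₁ x + Δ)} =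
    {R : Set (C → ℝ≥0) | ∃ Δ : ℝ≥0, R = regionOf c (fun x => κ₂ x + Δ)} := by
  ext R
  constructor
  · rintro ⟨Δ, rfl⟩
    obtain ⟨Δ', h'⟩ := h.exists_delay Δ
    exact ⟨Δ', h'.regionOf_eq⟩
  · rintro ⟨Δ, rfl⟩
    obtain ⟨Δ', h'⟩ := h.symm.exists_delay Δ
    exact ⟨Δ', h'.regionOf_eq⟩
end

section
/- Every clock region is convex: if κ₁ ≅ κ₂ are region-equivalent clock valuations and λ ∈ [0,1], then the valuation λ·κ₁ + (1−λ)·κ₂ (defined pointwise) is region-equivalent to κ₁. -/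
open scoped NNReal

theorem convexCombo_le_convexCombo_iff {s t a a' b b' : ℝ} (hs : 0 ≤ s) (ht : 0 ≤ t)
    (hst : s + t = 1) (h : a ≤ a' ↔ b ≤ b') :
    s * a + t * b ≤ s * a' + t * b' ↔ a ≤ a' := by
  refine ⟨fun hle => ?_, fun ha => ?_⟩
  · by_contra hn
    have hb : 0 < b - b' := sub_pos.2 (not_le.1 (mt h.2 hn))
    have ha : 0 < a - a' := sub_pos.2 (not_le.1 hn)
    have : 0 < s * (a - a') + t * (b - b') := convex_Ioi (0 : ℝ) ha hb hs ht hst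
    linarith
  · have hb := h.1 ha
    gcongr

theorem floor_convexCombo {s t a b : ℝ} (hs : 0 ≤ s) (ht : 0 ≤ t) (hst : s + t = 1)
    (h : ⌊a⌋ = ⌊b⌋) : ⌊s * a + t * b⌋ = ⌊a⌋ := by
  have ha : a ∈ Set.Ico (⌊a⌋ : ℝ) (⌊a⌋ + 1) := ⟨Int.floor_le a, Int.lt_floor_add_one a⟩
  have hb : b ∈ Set.Ico (⌊a⌋ : ℝ) (⌊a⌋ + 1) := by
    rw [h]
    exact ⟨Int.floor_le b, Int.lt_floor_add_one b⟩
  exact Int.floor_eq_iff.2 (convex_Ico _ _ ha hb hs ht hst)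

theorem fract_convexCombo {s t a b : ℝ} (hs : 0 ≤ s) (ht : 0 ≤ t) (hst : s + t = 1)
    (h : ⌊a⌋ = ⌊b⌋) :
    Int.fract (s * a + t * b) = s * Int.fract a + t * Int.fract b := by
  simp only [Int.fract, floor_convexCombo hs ht hst h, ← h]
  linear_combination (⌊a⌋ : ℝ) * hst

/-- Every clock region is convex: a pointwise convex combination of two
region-equivalent valuations is region-equivalent to them. -/
theorem region_convex
    {C : Type*} [Fintype C] (c : C → ℕ) (hc : ∀ x, 0 < c x)
    (κ₁ κ₂ : C → ℝ≥0) (h : RegionEquiv c κ₁ κ₂) (t : ℝ≥0) (ht : t ≤ 1) :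
    RegionEquiv c (fun x => t * κ₁ x + (1 - t) * κ₂ x) κ₁ := by
  obtain ⟨hle, hfloor, hfract, hzero⟩ := h
  have hs : (0 : ℝ) ≤ t := t.2
  have hs' : (0 : ℝ) ≤ 1 - t := sub_nonneg.2 (by exact_mod_cast ht)
  have hst : (t : ℝ) + (1 - t) = 1 := by ring
  have hbound (x : C) :
      (t : ℝ) * κ₁ x + (1 - t) * κ₂ x ≤ c x ↔ (κ₁ x : ℝ) ≤ c x := by
    rw [← convexCombo_le_convexCombo_iff hs hs' hst (hle x), ← add_mul, hst, one_mul]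
  simp only [RegionEquiv, NNReal.coe_add, NNReal.coe_mul, NNReal.coe_sub ht, NNReal.coe_one,
    hbound]
  refine ⟨fun _ => trivial, fun x hx => floor_convexCombo hs hs' hst (hfloor x hx),
    fun x y hx hy => ?_, fun x hx => ?_⟩
  · rw [fract_convexCombo hs hs' hst (hfloor x hx), fract_convexCombo hs hs' hst (hfloor y hy)]
    exact convexCombo_le_convexCombo_iff hs hs' hst (hfract x y hx hy)
  · have nonpos_iff (r : ℝ) : Int.fract r ≤ 0 ↔ Int.fract r = 0 :=
      (Int.fract_nonneg r).ge_iff_eq'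
    have hx0 := hzero x hx
    rw [← nonpos_iff, ← nonpos_iff] at hx0 ⊢
    rw [fract_convexCombo hs hs' hst (hfloor x hx),
      ← convexCombo_le_convexCombo_iff hs hs' hst hx0]
    simp only [mul_zero, add_zero]
end

section
/- Along a time line, each region is entered during a single interval of delays: for every clock valuation κ and all delays 0 ≤ Δ < Δ' < Δ'', if κ+Δ ≅ κ+Δ'' then κ+Δ ≅ κ+Δ'. Equivalently, for every clock valuation κ and every region R, the set { Δ ∈ ℝ≥0 : κ+Δ ∈ R } is a convex subset of ℝ (an interval). -/
open scoped NNReal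

/-- Along a time line, each region is entered during a single interval of delays. -/
theorem region_delay_interval_convex
    {C : Type*} [Fintype C] (c : C → ℕ) (hc : ∀ x, 0 < c x)
    (κ : C → ℝ≥0) (Δ Δ' Δ'' : ℝ≥0) (h₁ : Δ < Δ') (h₂ : Δ' < Δ'')
    (h : RegionEquiv c (fun x => κ x + Δ) (fun x => κ x + Δ'')) :
    RegionEquiv c (fun x => κ x + Δ) (fun x => κ x + Δ') := by
  obtain ⟨hle, hfloor, -, hzero⟩ := h
  have h₁' : (Δ : ℝ) < Δ' := NNReal.coe_lt_coe.mpr h₁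
  have h₂' : (Δ' : ℝ) < Δ'' := NNReal.coe_lt_coe.mpr h₂
  simp only [NNReal.coe_add] at hle hfloor hzero
  have floor_eq (x : C) (hx : (κ x : ℝ) + Δ ≤ c x) :
      ⌊(κ x : ℝ) + Δ⌋ = ⌊(κ x : ℝ) + Δ'⌋ :=
    le_antisymm (Int.floor_le_floor (by linarith))
      ((Int.floor_le_floor (by linarith)).trans_eq (hfloor x hx).symm)
  simp only [RegionEquiv, NNReal.coe_add]
  refine ⟨fun x => ⟨fun hx => ?_, fun hx => by linarith⟩, floor_eq, fun x y hx hy => ?_,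
    fun x hx => ⟨fun h0 => ?_, fun h0 => ?_⟩⟩
  · linarith [(hle x).mp hx]
  · simp only [Int.fract, ← floor_eq x hx, ← floor_eq y hy]
    constructor <;> intro h <;> linarith
  · have h0'' := (hzero x hx).mp h0
    simp only [Int.fract, ← hfloor x hx] at h0 h0''
    linarith
  · simp only [Int.fract, ← floor_eq x hx] at h0
    linarith [Int.floor_le ((κ x : ℝ) + Δ)]
end

section
/- Time-successor regions are visited in the same order from all valuations of a region: let κ₁ ≅ κ₂ be region-equivalent clock valuations, and let Δ₁, Δ₁' ∈ ℝ≥0 with Δ₁ < Δ₁' and κ₁+Δ₁ not region-equivalent to κ₁+Δ₁'. Then for all Δ₂, Δ₂' ∈ ℝ≥0 such that κ₂+Δ₂ ≅ κ₁+Δ₁ and κ₂+Δ₂' ≅ κ₁+Δ₁', one has Δ₂ < Δ₂'. -/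
open scoped NNReal

/-- If `b ≅ a + d` lies below `b' ≅ a` pointwise, so that delaying leads back to the region
of `a`, then the delay `d` does not leave the region of `a`. -/
theorem RegionEquiv.add_of_le {C : Type*} {c : C → ℕ} {a b b' : C → ℝ≥0} {d : ℝ≥0}
    (hb' : RegionEquiv c b' a) (hb : RegionEquiv c b (fun x => a x + d))
    (hle : ∀ x, b x ≤ b' x) : RegionEquiv c a (fun x => a x + d) := by
  obtain ⟨bound', floor', -, zero'⟩ := hb'
  obtain ⟨bound, floor, -, zero⟩ := hb
  have hd : (0 : ℝ) ≤ d := d.2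
  have hle' : ∀ x, (b x : ℝ) ≤ b' x := fun x => by exact_mod_cast hle x
  simp only [NNReal.coe_add] at bound floor zero
  have hbound : ∀ x, (a x : ℝ) ≤ c x → (b x : ℝ) ≤ c x := fun x hx =>
    (hle' x).trans ((bound' x).2 hx)
  have hfloor : ∀ x, (a x : ℝ) ≤ c x →
      ⌊(a x : ℝ)⌋ = ⌊(a x : ℝ) + d⌋ ∧ ⌊(b x : ℝ)⌋ = ⌊(b' x : ℝ)⌋ := fun x hx => by
    have h₁ := floor' x ((bound' x).2 hx)
    have h₂ := floor x (hbound x hx)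
    have h₃ := Int.floor_le_floor (hle' x)
    have h₄ : ⌊(a x : ℝ)⌋ ≤ ⌊(a x : ℝ) + d⌋ := Int.floor_le_floor (by linarith)
    omega
  have hfract : ∀ x, (a x : ℝ) ≤ c x →
      Int.fract ((a x : ℝ) + d) = Int.fract (a x : ℝ) + d := fun x hx => by
    simp only [Int.fract, ← (hfloor x hx).1]
    ring
  simp only [RegionEquiv, NNReal.coe_add]
  refine ⟨fun x => ⟨fun hx => (bound x).1 (hbound x hx), fun hx => by linarith⟩,
    fun x hx => (hfloor x hx).1, fun x y hx hy => ?_, fun x hx => ⟨fun h₀ => ?_, fun h₀ => ?_⟩⟩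
  · rw [hfract x hx, hfract y hy, add_le_add_iff_right]
  · refine (zero x (hbound x hx)).1 (le_antisymm ?_ (Int.fract_nonneg _))
    rw [← (zero' x ((bound' x).2 hx)).2 h₀, Int.fract, Int.fract, (hfloor x hx).2]
    linarith [hle' x]
  · have h₁ := Int.fract_nonneg (a x : ℝ)
    linarith [hfract x hx]

/-- Time-successor regions are visited in the same order from all valuations
of a region. -/
theorem timeSuccessor_regions_same_order
    {C : Type*} [Fintype C] (c : C → ℕ) (hc : ∀ x, 0 < c x)
    (κ₁ κ₂ : C → ℝ≥0) (h : RegionEquiv c κ₁ κ₂)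
    (Δ₁ Δ₁' : ℝ≥0) (hlt : Δ₁ < Δ₁')
    (hne : ¬ RegionEquiv c (fun x => κ₁ x + Δ₁) (fun x => κ₁ x + Δ₁'))
    (Δ₂ Δ₂' : ℝ≥0)
    (h₂ : RegionEquiv c (fun x => κ₂ x + Δ₂) (fun x => κ₁ x + Δ₁))
    (h₂' : RegionEquiv c (fun x => κ₂ x + Δ₂') (fun x => κ₁ x + Δ₁')) :
    Δ₂ < Δ₂' := by
  by_contra hle
  obtain ⟨d, rfl⟩ := exists_add_of_le hlt.le
  simp only [← add_assoc] at hne h₂'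
  exact hne (h₂.add_of_le h₂' fun x => add_le_add_right (not_lt.1 hle) _)
end

section
/- Every nondegenerate delay interval contains a nondegenerate subinterval lying inside a single open region: for every clock valuation κ and all reals 0 ≤ α < β, there exist α', β' with α < α' < β' < β such that (i) for all Δ, Δ' ∈ [α', β'], κ+Δ ≅ κ+Δ', and (ii) for every Δ ∈ [α', β'] and every clock x with κ(x)+Δ ≤ c_x, the value κ(x)+Δ is not an integer (i.e., fract(κ(x)+Δ) ≠ 0). -/
open scoped NNReal

/-- Finitely many translates of a nondegenerate interval can be made to avoid the integers
simultaneously by shrinking the interval. -/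
theorem exists_Icc_forall_mem_Ioo_int {ι : Type*} (s : Finset ι) (f : ι → ℝ) {α β : ℝ}
    (hαβ : α < β) :
    ∃ a b : ℝ, α < a ∧ a < b ∧ b < β ∧
      ∀ i ∈ s, ∃ n : ℤ, ∀ t ∈ Set.Icc a b, (n : ℝ) < f i + t ∧ f i + t < n + 1 := by
  classical
  induction s using Finset.induction_on with
  | empty => exact ⟨(2 * α + β) / 3, (α + 2 * β) / 3, by linarith, by linarith, by linarith, by simp⟩
  | insert i s _ ih =>
    obtain ⟨a, b, ha, hab, hb, h⟩ := ih
    have hle := Int.floor_le (f i + a)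
    have hlt := Int.lt_floor_add_one (f i + a)
    obtain ⟨d, had, hd⟩ : ∃ d, a < d ∧ d < min b (⌊f i + a⌋ + 1 - f i) :=
      exists_between (lt_min hab (by linarith))
    obtain ⟨hdb, hdn⟩ := lt_min_iff.1 hd
    refine ⟨(a + d) / 2, d, by linarith, by linarith, by linarith, fun j hj => ?_⟩
    rcases Finset.mem_insert.1 hj with rfl | hj
    · exact ⟨⌊f j + a⌋, fun t ht => ⟨by linarith [ht.1], by linarith [ht.2]⟩⟩
    · obtain ⟨n, hn⟩ := h j hj
      exact ⟨n, fun t ht => hn t ⟨by linarith [ht.1], by linarith [ht.2]⟩⟩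

/-- Every nondegenerate delay interval contains a nondegenerate subinterval lying
inside a single open region. -/
theorem open_region_subinterval
    {C : Type*} [Fintype C] (c : C → ℕ) (hc : ∀ x, 0 < c x)
    (κ : C → ℝ≥0) (α β : ℝ) (hα : 0 ≤ α) (hαβ : α < β) :
    ∃ α' β' : ℝ, α < α' ∧ α' < β' ∧ β' < β ∧
      (∀ Δ ∈ Set.Icc α' β', ∀ Δ' ∈ Set.Icc α' β',
        RegionEquiv c (fun x => κ x + Real.toNNReal Δ)
          (fun x => κ x + Real.toNNReal Δ')) ∧
      (∀ Δ ∈ Set.Icc α' β', ∀ x : C,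
        (κ x : ℝ) + Δ ≤ c x → Int.fract ((κ x : ℝ) + Δ) ≠ 0) := by
  obtain ⟨a, b, ha, hab, hb, h⟩ :=
    exists_Icc_forall_mem_Ioo_int Finset.univ (fun x => (κ x : ℝ)) hαβ
  choose n hn using fun x => h x (Finset.mem_univ x)
  have hcoe : ∀ t ∈ Set.Icc a b, (Real.toNNReal t : ℝ) = t := fun t ht =>
    Real.coe_toNNReal t (by linarith [ht.1])
  have hfloor : ∀ x, ∀ t ∈ Set.Icc a b, ⌊(κ x : ℝ) + t⌋ = n x := fun x t ht =>
    Int.floor_eq_iff.2 ⟨(hn x t ht).1.le, (hn x t ht).2⟩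
  have hfract : ∀ x, ∀ t ∈ Set.Icc a b, Int.fract ((κ x : ℝ) + t) = κ x + t - n x :=
    fun x t ht => by rw [Int.fract, hfloor x t ht]
  have hbound : ∀ x, ∀ t ∈ Set.Icc a b, (κ x : ℝ) + t ≤ c x ↔ n x < (c x : ℤ) := by
    refine fun x t ht => ⟨fun hx => ?_, fun hx => ?_⟩
    · exact_mod_cast (hn x t ht).1.trans_le hx
    · have : (n x : ℝ) + 1 ≤ c x := by exact_mod_cast hx
      exact (hn x t ht).2.le.trans this
  have hne : ∀ x, ∀ t ∈ Set.Icc a b, Int.fract ((κ x : ℝ) + t) ≠ 0 := fun x t ht => by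
    rw [hfract x t ht]
    exact (sub_pos.2 (hn x t ht).1).ne'
  refine ⟨a, b, ha, hab, hb, fun t ht t' ht' => ?_, fun t ht x _ => hne x t ht⟩
  simp only [RegionEquiv, NNReal.coe_add, hcoe t ht, hcoe t' ht']
  refine ⟨fun x => (hbound x t ht).trans (hbound x t' ht').symm,
    fun x _ => (hfloor x t ht).trans (hfloor x t' ht').symm, fun x y _ _ => ?_,
    fun x _ => iff_of_false (hne x t ht) (hne x t' ht')⟩
  rw [hfract x t ht, hfract y t ht, hfract x t' ht', hfract y t' ht']
  constructor <;> intro hxy <;> linarith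
end

section
/- Every satisfiable open polytope constraint has an interior satisfying point with pairwise distinct nonzero fractional parts: let θ be an open constraint over a finite clock set C. If some clock valuation satisfies θ, then there exist a clock valuation κ satisfying θ and a real ε > 0 such that (i) every clock valuation κ' with |κ'(x) − κ(x)| < ε for all x ∈ C also satisfies θ, and (ii) the fractional parts fract(κ(x)), x ∈ C, are pairwise distinct and all nonzero. -/
open scoped NNReal

/-- Open constraints: `θ ::= x < d | x > d | x ≥ 0 | x < y | θ₁ ∧ θ₂`. -/
inductive OpenConstraint (C : Type*) where
  | lt  (x : C) (d : ℕ)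
  | gt  (x : C) (d : ℕ)
  | ge0 (x : C)
  | ltv (x y : C)
  | and (θ₁ θ₂ : OpenConstraint C)

/-- Satisfaction of an open constraint by a clock valuation. -/
def OpenConstraint.sat {C : Type*} (κ : C → ℝ≥0) : OpenConstraint C → Prop
  | .lt x d => (κ x : ℝ) < d
  | .gt x d => (d : ℝ) < κ x
  | .ge0 x => (0 : ℝ) ≤ κ x
  | .ltv x y => (κ x : ℝ) < κ y
  | .and θ₁ θ₂ => θ₁.sat κ ∧ θ₂.sat κ

/-- The satisfaction set of an open constraint is open. -/
theorem OpenConstraint.isOpen_setOf_sat {C : Type*} (θ : OpenConstraint C) :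
    IsOpen {κ : C → ℝ≥0 | θ.sat κ} := by
  induction θ with
  | lt x d => exact isOpen_lt (by fun_prop) continuous_const
  | gt x d => exact isOpen_lt continuous_const (by fun_prop)
  | ge0 x => simp [OpenConstraint.sat]
  | ltv x y => exact isOpen_lt (by fun_prop) (by fun_prop)
  | and θ₁ θ₂ h₁ h₂ => exact h₁.inter h₂

/-- Along a line whose direction has nonzero, pairwise distinct coordinates, all but countably
many points have pairwise distinct nonzero fractional parts. -/
theorem countable_compl_fract_injective_ne_zero {C : Type*} [Countable C] (a v : C → ℝ)
    (hv : Function.Injective v) (hv0 : ∀ x, v x ≠ 0) :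
    {δ : ℝ | (∀ x y, x ≠ y → Int.fract (a x + δ * v x) ≠ Int.fract (a y + δ * v y)) ∧
      ∀ x, Int.fract (a x + δ * v x) ≠ 0}ᶜ.Countable := by
  refine ((Set.countable_range fun p : C × C × ℤ ↦
    (p.2.2 - (a p.1 - a p.2.1)) / (v p.1 - v p.2.1)).union
    (Set.countable_range fun p : C × ℤ ↦ (p.2 - a p.1) / v p.1)).mono ?_
  intro δ hδ
  rw [Set.mem_compl_iff, Set.mem_ofPred_eq, not_and_or] at hδ
  push Not at hδ
  rcases hδ with ⟨x, y, hxy, h⟩ | ⟨x, h⟩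
  · obtain ⟨m, hm⟩ := Int.fract_eq_fract.1 h
    refine Or.inl ⟨(x, y, m), ?_⟩
    rw [div_eq_iff (sub_ne_zero.2 (hv.ne hxy))]
    linarith
  · obtain ⟨m, hm⟩ := Int.fract_eq_zero_iff.1 h
    refine Or.inr ⟨(x, m), ?_⟩
    rw [div_eq_iff (hv0 x)]
    linarith

/-- Every satisfiable open polytope constraint has an interior satisfying point with
pairwise distinct nonzero fractional parts. -/
theorem open_constraint_interior_point
    {C : Type*} [Fintype C] (θ : OpenConstraint C)
    (hsat : ∃ κ : C → ℝ≥0, θ.sat κ) :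
    ∃ (κ : C → ℝ≥0) (ε : ℝ), 0 < ε ∧ θ.sat κ ∧
      (∀ κ' : C → ℝ≥0, (∀ x, |(κ' x : ℝ) - (κ x : ℝ)| < ε) → θ.sat κ') ∧
      (∀ x y : C, x ≠ y → Int.fract (κ x : ℝ) ≠ Int.fract (κ y : ℝ)) ∧
      (∀ x : C, Int.fract (κ x : ℝ) ≠ 0) := by
  obtain ⟨κ₀, h₀⟩ := hsat
  let v : C → ℝ≥0 := fun x ↦ ((Fintype.equivFin C x : ℕ) + 1 : ℕ)
  have hv : Function.Injective fun x ↦ (v x : ℝ) := by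
    intro x y h
    simpa [v, Fin.val_inj] using h
  have hv0 : ∀ x, (v x : ℝ) ≠ 0 := by
    intro x
    simp only [v, NNReal.coe_natCast]
    positivity
  let γ : ℝ → C → ℝ≥0 := fun δ x ↦ κ₀ x + δ.toNNReal * v x
  have hγ : Continuous γ := by fun_prop
  obtain ⟨r, hr, hball⟩ := Metric.isOpen_iff.1 (θ.isOpen_setOf_sat.preimage hγ) 0
    (by simpa [γ] using h₀)
  have hdense := (countable_compl_fract_injective_ne_zero
    (fun x ↦ (κ₀ x : ℝ)) (fun x ↦ (v x : ℝ)) hv hv0).dense_compl ℝ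
  rw [compl_compl] at hdense
  obtain ⟨δ, ⟨hinj, hne⟩, hδ0, hδr⟩ := hdense.exists_between hr
  have hsat : θ.sat (γ δ) := hball (by simpa [abs_of_pos hδ0] using hδr)
  obtain ⟨ε, hε, hεball⟩ := Metric.isOpen_iff.1 θ.isOpen_setOf_sat (γ δ) hsat
  have hcoe : ∀ x, (γ δ x : ℝ) = κ₀ x + δ * v x := fun x ↦ by
    simp [γ, Real.coe_toNNReal δ hδ0.le]
  refine ⟨γ δ, ε, hε, hsat, fun κ' h ↦ hεball ((dist_pi_lt_iff hε).2 h), ?_, ?_⟩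
  · simpa only [hcoe] using hinj
  · simpa only [hcoe] using hne
end

section
/- Feasibility of infinitely cycling with limit-robust timing (winning the safety objective in the timed automaton game of Figure 1 from x = y = 0 with a limit-robust strategy): there exist sequences α₁, β₁, α₂, β₂ : ℕ → ℝ with α₁(j) < β₁(j) and α₂(j) < β₂(j) for every j ∈ ℕ, such that for all sequences d₁, d₂ : ℕ → ℝ satisfying d₁(j) ∈ [α₁(j), β₁(j)] and d₂(j) ∈ [α₂(j), β₂(j)] for every j, the cumulative sums s(m) = ∑_{j=0}^{m} d₁(j) and t(m) = ∑_{j=0}^{m} d₂(j) satisfy: 0 ≤ s(0) ≤ 1, t(0) > 1, and for every m ∈ ℕ: s(m+1) − s(m) ≤ 1, t(m+1) − t(m) > 1, and s(m) ≤ t(m) ≤ s(m+1). -/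
/-- Sum of a geometric sequence with first term `1 / 4` and ratio `1 / 2`. -/
theorem sum_quarter_mul_half_pow (n : ℕ) :
    ∑ j ∈ Finset.range n, (1 / 4 : ℝ) * (1 / 2) ^ j = 1 / 2 * (1 - (1 / 2) ^ n) := by
  induction n with
  | zero => simp
  | succ n ih => rw [Finset.sum_range_succ, ih]; ring

/-- Delays with lower bounds `1 - 2⁻ʲ / 4` have partial sums above `n - 1 / 2`. -/
theorem sub_half_le_sum_range {d : ℕ → ℝ} (hd : ∀ j, 1 - 1 / 4 * (1 / 2) ^ j ≤ d j) (n : ℕ) :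
    (n : ℝ) - 1 / 2 ≤ ∑ j ∈ Finset.range n, d j := by
  have h := Finset.sum_le_sum fun j (_ : j ∈ Finset.range n) => hd j
  rw [Finset.sum_sub_distrib, sum_quarter_mul_half_pow] at h
  simp only [Finset.sum_const, Finset.card_range, nsmul_eq_mul, mul_one] at h
  have hp : (0 : ℝ) < (1 / 2) ^ n := by positivity
  linarith

/-- Delays with upper bounds `1 + 2⁻ʲ / 4` have partial sums below `n + 1 / 2`. -/
theorem sum_range_le_add_half {d : ℕ → ℝ} (hd : ∀ j, d j ≤ 1 + 1 / 4 * (1 / 2) ^ j) (n : ℕ) :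
    ∑ j ∈ Finset.range n, d j ≤ n + 1 / 2 := by
  have h := Finset.sum_le_sum fun j (_ : j ∈ Finset.range n) => hd j
  rw [Finset.sum_add_distrib, sum_quarter_mul_half_pow] at h
  simp only [Finset.sum_const, Finset.card_range, nsmul_eq_mul, mul_one] at h
  have hp : (0 : ℝ) < (1 / 2) ^ n := by positivity
  linarith

/-- Feasibility of infinitely cycling with limit-robust timing in the timed automaton
game of Figure 1 from `x = y = 0`: player 1 prescribes nondegenerate delay intervals,
and every adversarial choice of delays from these intervals yields an infinite cycle. -/
theorem limit_robust_cycling_feasible :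
    ∃ α₁ β₁ α₂ β₂ : ℕ → ℝ,
      (∀ j : ℕ, α₁ j < β₁ j) ∧ (∀ j : ℕ, α₂ j < β₂ j) ∧
      ∀ d₁ d₂ : ℕ → ℝ,
        (∀ j : ℕ, d₁ j ∈ Set.Icc (α₁ j) (β₁ j)) →
        (∀ j : ℕ, d₂ j ∈ Set.Icc (α₂ j) (β₂ j)) →
        ((0 ≤ ∑ j ∈ Finset.range 1, d₁ j ∧ (∑ j ∈ Finset.range 1, d₁ j) ≤ 1) ∧
         1 < ∑ j ∈ Finset.range 1, d₂ j ∧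
         ∀ m : ℕ,
           (∑ j ∈ Finset.range (m + 2), d₁ j) - (∑ j ∈ Finset.range (m + 1), d₁ j) ≤ 1 ∧
           1 < (∑ j ∈ Finset.range (m + 2), d₂ j) - (∑ j ∈ Finset.range (m + 1), d₂ j) ∧
           (∑ j ∈ Finset.range (m + 1), d₁ j) ≤ (∑ j ∈ Finset.range (m + 1), d₂ j) ∧
           (∑ j ∈ Finset.range (m + 1), d₂ j) ≤ (∑ j ∈ Finset.range (m + 2), d₁ j)) := by
  have hpos (j : ℕ) : (0 : ℝ) < (1 / 2) ^ j := by positivity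
  refine ⟨fun j => 1 - 1 / 4 * (1 / 2) ^ j, fun _ => 1, fun j => 1 + 1 / 8 * (1 / 2) ^ j,
    fun j => 1 + 1 / 4 * (1 / 2) ^ j, fun j => by linarith [hpos j],
    fun j => by linarith [hpos j], fun d₁ d₂ h₁ h₂ => ?_⟩
  have hd₁ (j : ℕ) : d₁ j ≤ 1 := (h₁ j).2
  have hd₂ (j : ℕ) : 1 < d₂ j := by linarith [hpos j, (h₂ j).1]
  have hs := sub_half_le_sum_range fun j => (h₁ j).1
  have ht := sum_range_le_add_half fun j => (h₂ j).2
  refine ⟨⟨?_, by simpa using hd₁ 0⟩, by simpa using hd₂ 0, fun m => ⟨?_, ?_, ?_, ?_⟩⟩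
  · have := hs 1
    push_cast at this
    linarith
  · rw [Finset.sum_range_succ _ (m + 1)]
    linarith [hd₁ (m + 1)]
  · rw [Finset.sum_range_succ _ (m + 1)]
    linarith [hd₂ (m + 1)]
  · exact Finset.sum_le_sum fun j _ => (hd₁ j).trans (hd₂ j).le
  · have hs' := hs (m + 2)
    have ht' := ht (m + 1)
    push_cast at hs' ht'
    linarith
end

section
/- Impossibility of infinitely cycling under any fixed positive jitter (player 1 cannot win the game of Figure 1 with a bounded-robust strategy for any jitter bound): for every real ε > 0, there do not exist sequences s, t : ℕ → ℝ such that for every j ∈ ℕ: s(j+1) − s(j) ≤ 1 − ε, t(j+1) − t(j) > 1, and s(j) ≤ t(j) ≤ s(j+1). -/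
/-- Impossibility of infinitely cycling in the timed automaton game of Figure 1
under any fixed positive jitter bound. -/
theorem bounded_jitter_cycling_infeasible (ε : ℝ) (hε : 0 < ε) :
    ¬ ∃ s t : ℕ → ℝ,
        ∀ j : ℕ, s (j + 1) - s j ≤ 1 - ε ∧ 1 < t (j + 1) - t j ∧
          s j ≤ t j ∧ t j ≤ s (j + 1) := by
  rintro ⟨s, t, h⟩
  have hs : ∀ j : ℕ, s j ≤ s 0 + j * (1 - ε) := by
    intro j
    induction j with
    | zero => simp
    | succ k ih =>
      push_cast
      linarith [(h k).1]
  have ht : ∀ j : ℕ, t 0 + j ≤ t j := by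
    intro j
    induction j with
    | zero => simp
    | succ k ih =>
      push_cast
      linarith [(h k).2.1]
  obtain ⟨n, hn⟩ := exists_nat_gt (1 / ε)
  rw [div_lt_iff₀ hε] at hn
  have hsn := hs (n + 1)
  push_cast at hsn
  linarith [ht n, (h n).2.2.2, (h 0).2.2.1]
end
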